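/- arXiv:1204.0224 — 2 statements merged into one kernel-verified Lean document; each statement's English description precedes it below -/
import Mathlib

section
/- Let A ∈ M_n(ℤ) with det A ≠ 0 and let f_A(x) = det(xI − A) be its characteristic polynomial. If no unimodular polynomial divides f_A in ℤ[x], then every affine local homeomorphism T of 𝕋ⁿ with linear part φ_A (i.e. T(x) = λ + φ_A(x) for some λ ∈ 𝕋ⁿ) is exact and is topologically conjugate to φ_A, i.e. there is a homeomorphism h of 𝕋ⁿ with h ∘ T ∘ h⁻¹ = φ_A. -/
/-- The `n`-torus `𝕋ⁿ = (ℝ/ℤ)ⁿ`, written additively. -/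
abbrev Torus (n : ℕ) := Fin n → AddCircle (1 : ℝ)

/-- For an integer matrix `A ∈ Mₙ(ℤ)`, the group endomorphism `φ_A : 𝕋ⁿ → 𝕋ⁿ`
induced on the quotient by the linear map `x ↦ Ax` on `ℝⁿ`. -/
noncomputable def phiA {n : ℕ} (A : Matrix (Fin n) (Fin n) ℤ) (x : Torus n) : Torus n :=
  fun i => ∑ j, A i j • x j

/-- A nonconstant monic integer polynomial with constant term `±1` is unimodular. -/
def IsUnimodular (p : Polynomial ℤ) : Prop :=
  p.Monic ∧ 0 < p.natDegree ∧ (p.coeff 0 = 1 ∨ p.coeff 0 = -1)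

/-- A continuous map `ψ : X → X` is exact if for every nonempty open subset
`V ⊆ X` there is `N ∈ ℕ` such that `ψ^N(V) = X`. -/
def ExactMap {X : Type*} [TopologicalSpace X] (ψ : X → X) : Prop :=
  ∀ V : Set X, IsOpen V → V.Nonempty → ∃ N : ℕ, ψ^[N] '' V = Set.univ

open MeasureTheory UnitAddTorus Polynomial Matrix

/-- The character of the torus attached to an integer vector is multiplicative. -/
theorem UnitAddTorus.mFourier_apply_add {d : Type*} [Fintype d] (m : d → ℤ)
    (x y : UnitAddTorus d) : mFourier m (x + y) = mFourier m x * mFourier m y := by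
  simp [mFourier, fourier_apply, smul_add, AddCircle.toCircle_add, Finset.prod_mul_distrib]

/-- For an increasing sequence of finite subgroups of the torus that no nontrivial character
annihilates, the averages of a trigonometric polynomial are eventually equal to its integral. -/
theorem exists_forall_sum_eq_card_mul_integral {d : Type*} [Fintype d]
    (μ : Measure (UnitAddTorus d)) [IsProbabilityMeasure μ] [μ.IsAddLeftInvariant]
    (K : ℕ → AddSubgroup (UnitAddTorus d)) [∀ k, Fintype (K k)] (hK : Monotone K)
    (hsep : ∀ m : d → ℤ, m ≠ 0 → ∃ k, ∃ x ∈ K k, mFourier m x ≠ 1)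
    (g : C(UnitAddTorus d, ℂ)) (hg : g ∈ Submodule.span ℂ (Set.range (mFourier (d := d)))) :
    ∃ N, ∀ k ≥ N, ∑ x : K k, g x = Fintype.card (K k) * ∫ x, g x ∂μ := by
  have hint (f : C(UnitAddTorus d, ℂ)) : Integrable f μ :=
    f.continuous.integrable_of_hasCompactSupport (HasCompactSupport.of_compactSpace f)
  induction hg using Submodule.span_induction with
  | mem f hf =>
    obtain ⟨m, rfl⟩ := hf
    by_cases hm : m = 0
    · subst hm
      exact ⟨0, fun k _ => by simp [mFourier_zero]⟩
    obtain ⟨N, a, ha, hne⟩ := hsep m hm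
    refine ⟨N, fun k hk => ?_⟩
    have h1 : ∑ x : K k, mFourier m x = 0 := by
      have h := Equiv.sum_comp (Equiv.addLeft (⟨a, hK hk ha⟩ : K k)) fun x => mFourier m x
      simp only [Equiv.coe_addLeft, AddSubgroup.coe_add, mFourier_apply_add,
        ← Finset.mul_sum] at h
      exact (mul_left_eq_self₀.1 h).resolve_left hne
    have h2 : ∫ x, mFourier m x ∂μ = 0 := by
      have h := integral_add_left_eq_self (μ := μ) (fun x => mFourier m x) a
      simp only [mFourier_apply_add, integral_const_mul] at h
      exact (mul_left_eq_self₀.1 h).resolve_left hne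
    rw [h1, h2, mul_zero]
  | zero => exact ⟨0, fun k _ => by simp⟩
  | add f g _ _ hf hg =>
    obtain ⟨N, hN⟩ := hf
    obtain ⟨M, hM⟩ := hg
    refine ⟨max N M, fun k hk => ?_⟩
    simp only [ContinuousMap.add_apply]
    rw [Finset.sum_add_distrib, integral_add (hint f) (hint g), mul_add,
      hN k (le_of_max_le_left hk), hM k (le_of_max_le_right hk)]
  | smul c f _ hf =>
    obtain ⟨N, hN⟩ := hf
    refine ⟨N, fun k hk => ?_⟩
    simp only [ContinuousMap.smul_apply, smul_eq_mul]
    rw [← Finset.mul_sum, hN k hk, integral_const_mul]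
    ring

/-- An increasing union of finite subgroups of the torus that no nontrivial character annihilates
is dense. -/
theorem dense_iUnion_of_mFourier_ne_one {d : Type*} [Fintype d]
    (K : ℕ → AddSubgroup (UnitAddTorus d)) [∀ k, Finite (K k)] (hK : Monotone K)
    (hsep : ∀ m : d → ℤ, m ≠ 0 → ∃ k, ∃ x ∈ K k, mFourier m x ≠ 1) :
    Dense (⋃ k, (K k : Set (UnitAddTorus d))) := by
  have : ∀ k, Fintype (K k) := fun k => Fintype.ofFinite _
  by_contra hD
  obtain ⟨x₀, hx₀⟩ : ∃ x, x ∉ closure (⋃ k, (K k : Set (UnitAddTorus d))) := by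
    simpa [Dense] using hD
  obtain ⟨u, hu0, hu1, hu⟩ := exists_continuous_zero_one_of_isClosed isClosed_closure
    (isClosed_singleton (x := x₀)) (Set.disjoint_singleton_right.2 hx₀)
  let μ : Measure (UnitAddTorus d) := Measure.addHaarMeasure ⊤
  have : IsProbabilityMeasure μ := ⟨Measure.addHaarMeasure_self⟩
  have hint (f : C(UnitAddTorus d, ℂ)) : Integrable f μ :=
    f.continuous.integrable_of_hasCompactSupport (HasCompactSupport.of_compactSpace f)
  have hpos : 0 < ∫ x, u x ∂μ :=
    u.continuous.integral_pos_of_hasCompactSupport_nonneg_nonzero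
      (HasCompactSupport.of_compactSpace u) (fun x => (hu x).1) (x := x₀) (by simp [hu1 rfl])
  let f : C(UnitAddTorus d, ℂ) := ⟨fun x => (u x : ℂ), by fun_prop⟩
  have hf : ∫ x, f x ∂μ = ((∫ x, u x ∂μ : ℝ) : ℂ) := integral_ofReal
  set c := ∫ x, u x ∂μ
  have hmem : f ∈ closure
      (Submodule.span ℂ (Set.range (mFourier (d := d))) : Set C(UnitAddTorus d, ℂ)) := by
    rw [← Submodule.topologicalClosure_coe, span_mFourier_closure_eq_top]
    trivial
  obtain ⟨g, hg, hfg⟩ := Metric.mem_closure_iff.1 hmem (c / 3) (by positivity)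
  rw [dist_eq_norm] at hfg
  have hle (x) : ‖f x - g x‖ ≤ c / 3 := ((f - g).norm_coe_le_norm x).trans hfg.le
  obtain ⟨N, hN⟩ := exists_forall_sum_eq_card_mul_integral μ K hK hsep g hg
  have h1 : ‖∫ x, g x ∂μ‖ ≤ c / 3 := by
    have hcard : (0 : ℝ) < Fintype.card (K N) := by exact_mod_cast Fintype.card_pos
    have h : ‖∑ x : K N, g x‖ ≤ Fintype.card (K N) * (c / 3) := by
      refine (norm_sum_le _ _).trans ((Finset.sum_le_card_nsmul _ _ (c / 3) fun x _ => ?_).trans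
        (by simp))
      have hx : u x = 0 := hu0 (subset_closure (Set.mem_iUnion.2 ⟨N, x.2⟩))
      simpa [f, hx] using hle x
    rw [hN N le_rfl, norm_mul, Complex.norm_natCast] at h
    exact le_of_mul_le_mul_left h hcard
  have h2 : ‖∫ x, f x ∂μ - ∫ x, g x ∂μ‖ ≤ c / 3 := by
    rw [← integral_sub (hint f) (hint g)]
    simpa using norm_integral_le_of_norm_le_const (μ := μ) (Filter.Eventually.of_forall hle)
  have h3 : ‖∫ x, f x ∂μ‖ = c := by rw [hf, Complex.norm_real, Real.norm_of_nonneg hpos.le]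
  have := norm_le_norm_add_norm_sub' (∫ x, f x ∂μ) (∫ x, g x ∂μ)
  linarith

/-- If an integer polynomial in an endomorphism of a rational vector space kills a nonzero vector,
then so does one of its irreducible factors, possibly for another vector. -/
theorem exists_irreducible_dvd_aeval_apply_eq_zero {V : Type*} [AddCommGroup V] [Module ℚ V]
    (f : Module.End ℚ V) (q : ℤ[X]) (hq : q ≠ 0) (v : V) (hv : v ≠ 0) (h : aeval f q v = 0) :
    ∃ p, Irreducible p ∧ p ∣ q ∧ ∃ w ≠ 0, aeval f p w = 0 := by
  induction q using WfDvdMonoid.induction_on_irreducible generalizing v with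
  | zero => exact absurd rfl hq
  | unit u hu =>
    obtain ⟨u', hu'⟩ := hu.exists_left_inv
    refine absurd ?_ hv
    have := congrArg (aeval f u') h
    rwa [← Module.End.mul_apply, ← map_mul, hu', map_one, map_zero] at this
  | mul a p ha hp ih =>
    by_cases hav : aeval f a v = 0
    · obtain ⟨r, hr, hra, hw⟩ := ih ha v hv hav
      exact ⟨r, hr, hra.mul_left p, hw⟩
    · exact ⟨p, hp, dvd_mul_right p a, _, hav, by rwa [← Module.End.mul_apply, ← map_mul]⟩

/-- A unimodular integer polynomial that kills a nonzero vector shares a unimodular factor with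
every integer polynomial that kills the whole space. -/
theorem IsUnimodular.exists_dvd_of_aeval_apply_eq_zero {V : Type*} [AddCommGroup V] [Module ℚ V]
    (f : Module.End ℚ V) {q χ : ℤ[X]} (hq : IsUnimodular q) (hf : aeval f χ = 0)
    (v : V) (hv : v ≠ 0) (h : aeval f q v = 0) : ∃ p, IsUnimodular p ∧ p ∣ χ := by
  obtain ⟨p, hp, hpq, w, hw, hpw⟩ :=
    exists_irreducible_dvd_aeval_apply_eq_zero f q hq.1.ne_zero v hv h
  obtain ⟨r, rfl⟩ := hpq
  obtain ⟨p, s, hp, hps, hpm, hpw⟩ : ∃ p' s', Irreducible p' ∧ p' * s' = p * r ∧ p'.Monic ∧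
      aeval f p' w = 0 := by
    have hl : p.leadingCoeff * r.leadingCoeff = 1 := by
      rw [← leadingCoeff_mul]; exact hq.1
    rcases Int.isUnit_iff.1 (IsUnit.of_mul_eq_one _ hl) with h1 | h1
    · exact ⟨p, r, hp, rfl, h1, hpw⟩
    · exact ⟨-p, -r, (Associated.neg_left (Associated.refl p)).symm.irreducible hp, by ring,
        by simp [Monic, h1], by simp [hpw]⟩
  rw [← hps] at hq
  refine ⟨p, ⟨hpm, ?_, ?_⟩, ?_⟩
  · exact hpm.natDegree_pos_of_not_isUnit hp.not_isUnit
  · have hc : IsUnit (p.coeff 0 * s.coeff 0) := by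
      rw [← mul_coeff_zero]; exact Int.isUnit_iff.2 hq.2.2
    exact Int.isUnit_iff.1 (isUnit_of_mul_isUnit_left hc)
  · by_contra hndvd
    have hirr := (hpm.irreducible_iff_irreducible_map_fraction_map (K := ℚ)).1 hp
    rw [IsPrimitive.Int.dvd_iff_map_cast_dvd_map_cast p χ hpm.isPrimitive] at hndvd
    obtain ⟨a, b, hab⟩ := (hirr.coprime_iff_not_dvd).2 hndvd
    refine hw ?_
    have hmap (t : ℤ[X]) : aeval f (t.map (Int.castRingHom ℚ)) = aeval f t :=
      aeval_map_algebraMap ℚ f t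
    have := congrArg (fun t => aeval f t w) hab
    simpa [hmap, hpw, hf] using this.symm

/-- The integer row vectors divisible by every power of an integer matrix. -/
def Matrix.divisibleVectors {ι : Type*} [Fintype ι] [DecidableEq ι] (A : Matrix ι ι ℤ) :
    Submodule ℤ (ι → ℤ) :=
  ⨅ k : ℕ, LinearMap.range (A ^ k).vecMulLinear

theorem Matrix.mem_divisibleVectors {ι : Type*} [Fintype ι] [DecidableEq ι] {A : Matrix ι ι ℤ}
    {m : ι → ℤ} : m ∈ A.divisibleVectors ↔ ∀ k : ℕ, ∃ z, Matrix.vecMul z (A ^ k) = m := by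
  simp [divisibleVectors]

/-- If the characteristic polynomial of a nonsingular integer matrix has no unimodular factor,
then no nonzero integer vector is divisible by all powers of the matrix. -/
theorem Matrix.divisibleVectors_eq_bot {ι : Type*} [Fintype ι] [DecidableEq ι]
    {A : Matrix ι ι ℤ} (hA : A.det ≠ 0)
    (hdiv : ¬ ∃ q : ℤ[X], IsUnimodular q ∧ q ∣ A.charpoly) : A.divisibleVectors = ⊥ := by
  by_contra hL
  set L := A.divisibleVectors
  have hmaps : ∀ m ∈ L, A.vecMulLinear m ∈ L := by
    intro m hm
    rw [mem_divisibleVectors] at hm ⊢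
    intro k
    obtain ⟨z, rfl⟩ := hm k
    exact ⟨z ᵥ* A, by simp [Matrix.vecMul_vecMul, pow_mul_comm']⟩
  have hinj (z : ι → ℤ) (hz : z ᵥ* A = 0) : z = 0 := Matrix.eq_zero_of_vecMul_eq_zero hA hz
  let g : Module.End ℤ L := A.vecMulLinear.restrict hmaps
  have hg (m : L) : (g m : ι → ℤ) = m ᵥ* A := rfl
  have hg_inj : Function.Injective g := by
    rw [injective_iff_map_eq_zero]
    intro m hm
    exact Subtype.ext (hinj _ (by rw [← hg, hm]; rfl))
  have hg_surj : Function.Surjective g := by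
    rintro ⟨m, hm⟩
    have hm' := mem_divisibleVectors.1 hm
    obtain ⟨z, hz⟩ := hm' 1
    refine ⟨⟨z, mem_divisibleVectors.2 fun k => ?_⟩, Subtype.ext (by simpa [hg] using hz)⟩
    obtain ⟨y, hy⟩ := hm' (k + 1)
    refine ⟨y, sub_eq_zero.1 (hinj _ ?_)⟩
    rw [sub_vecMul, vecMul_vecMul, ← pow_succ, hy, ← hz, pow_one, sub_self]
  have hrank : 0 < Module.finrank ℤ L := by
    have : Nontrivial L := Submodule.nontrivial_iff_ne_bot.2 hL
    exact Module.finrank_pos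
  have hdet : IsUnit (LinearMap.det g) :=
    (LinearMap.isUnit_iff_isUnit_det g).1 ((Module.End.isUnit_iff g).2 ⟨hg_inj, hg_surj⟩)
  have huni : IsUnimodular g.charpoly := by
    refine ⟨g.charpoly_monic, by rwa [g.charpoly_natDegree], ?_⟩
    rw [LinearMap.det_eq_sign_charpoly_coeff] at hdet
    exact Int.isUnit_iff.1 (isUnit_of_mul_isUnit_right hdet)
  obtain ⟨m, hmL, hm0⟩ := (Submodule.ne_bot_iff L).1 hL
  let B : Matrix ι ι ℚ := A.map (Int.castRingHom ℚ)
  let f : Module.End ℚ (ι → ℚ) := Matrix.toLin' Bᵀ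
  let c : L →+ (ι → ℚ) :=
    ((Int.castRingHom ℚ).toAddMonoidHom.compLeft ι).comp L.subtype.toAddMonoidHom
  have hfc (x : L) : f (c x) = c (g x) := by
    ext i
    simp [f, c, B, hg, Matrix.vecMul, Matrix.mulVec, dotProduct, mul_comm]
  have hpoly (p : ℤ[X]) (x : L) : aeval f p (c x) = c (aeval g p x) := by
    induction p using Polynomial.induction_on generalizing x with
    | C a => simp
    | add p q hp hq => simp [hp, hq]
    | monomial k a ih =>
      rw [pow_succ, ← mul_assoc, map_mul _ _ X, map_mul _ _ X, aeval_X, aeval_X,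
        Module.End.mul_apply, Module.End.mul_apply, hfc, ih]
  refine hdiv (huni.exists_dvd_of_aeval_apply_eq_zero f ?_ (c ⟨m, hmL⟩) ?_ ?_)
  · have h := f.aeval_self_charpoly
    rw [Matrix.charpoly_toLin', Matrix.charpoly_transpose, Matrix.charpoly_map] at h
    exact (aeval_map_algebraMap ℚ f A.charpoly).symm.trans h
  · refine fun h => hm0 (funext fun i => ?_)
    simpa [c] using congrFun h i
  · rw [hpoly, LinearMap.aeval_self_charpoly]
    simp

/-- The endomorphism of the torus induced by an integer matrix, as a group homomorphism. -/
noncomputable def phiAHom {n : ℕ} (A : Matrix (Fin n) (Fin n) ℤ) : Torus n →+ Torus n where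
  toFun := phiA A
  map_zero' := by ext; simp [phiA]
  map_add' x y := by ext; simp [phiA, Finset.sum_add_distrib]

@[simp]
theorem phiAHom_apply {n : ℕ} (A : Matrix (Fin n) (Fin n) ℤ) (x : Torus n) :
    phiAHom A x = phiA A x := rfl

theorem phiA_mul {n : ℕ} (A B : Matrix (Fin n) (Fin n) ℤ) (x : Torus n) :
    phiA (A * B) x = phiA A (phiA B x) := by
  ext i
  simp only [phiA, Matrix.mul_apply, Finset.sum_smul, Finset.smul_sum, mul_smul]
  exact Finset.sum_comm

theorem phiA_smul_one {n : ℕ} (d : ℤ) (x : Torus n) : phiA (d • 1) x = d • x := by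
  ext i
  simp [phiA, Matrix.one_apply]

theorem phiA_sub {n : ℕ} (A B : Matrix (Fin n) (Fin n) ℤ) (x : Torus n) :
    phiA (A - B) x = phiA A x - phiA B x := by
  ext i
  simp [phiA, sub_smul]

theorem phiA_one {n : ℕ} (x : Torus n) : phiA 1 x = x := by
  simpa using phiA_smul_one 1 x

theorem phiA_iterate {n : ℕ} (A : Matrix (Fin n) (Fin n) ℤ) (k : ℕ) (x : Torus n) :
    (phiA A)^[k] x = phiA (A ^ k) x := by
  induction k with
  | zero => simp [phiA_one]
  | succ k ih => rw [Function.iterate_succ_apply', ih, pow_succ', phiA_mul]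

theorem phiA_surjective {n : ℕ} {A : Matrix (Fin n) (Fin n) ℤ} (hA : A.det ≠ 0) :
    Function.Surjective (phiA A) := by
  intro y
  have hdiv (u : AddCircle (1 : ℝ)) : ∃ w : AddCircle (1 : ℝ), A.det • w = u := by
    obtain ⟨r, rfl⟩ := QuotientAddGroup.mk_surjective u
    refine ⟨((r / A.det : ℝ) : AddCircle (1 : ℝ)), ?_⟩
    rw [← AddCircle.coe_zsmul, zsmul_eq_mul, mul_div_cancel₀ _ (by exact_mod_cast hA)]
  choose w hw using fun i => hdiv (y i)
  refine ⟨phiA A.adjugate w, ?_⟩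
  rw [← phiA_mul, Matrix.mul_adjugate, phiA_smul_one]
  exact funext hw

theorem finite_ker_phiAHom {n : ℕ} {A : Matrix (Fin n) (Fin n) ℤ} (hA : A.det ≠ 0) :
    Finite (phiAHom A).ker := by
  have hfin : {u : AddCircle (1 : ℝ) | A.det • u = 0}.Finite :=
    AddCircle.finite_torsion_of_isSMulRegular_int _ _ fun a b h => by
      simpa [zsmul_eq_mul, hA] using h
  refine ((Set.Finite.pi' fun _ : Fin n => hfin).subset fun x hx i => ?_).to_subtype
  have h := phiA_mul A.adjugate A x
  rw [← phiAHom_apply A, (phiAHom A).mem_ker.1 hx, Matrix.adjugate_mul, phiA_smul_one,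
    ← phiAHom_apply, map_zero] at h
  exact congrFun h i

theorem UnitAddTorus.mFourier_eq_toCircle {d : Type*} [Fintype d] (m : d → ℤ)
    (x : UnitAddTorus d) : mFourier m x = (AddCircle.toCircle (∑ i, m i • x i) : ℂ) := by
  have h (s : Finset d) : (AddCircle.toCircle (∑ i ∈ s, m i • x i) : ℂ) =
      ∏ i ∈ s, fourier (m i) (x i) := by
    classical
    induction s using Finset.induction_on with
    | empty => simp
    | insert i s hi ih =>
      simp [Finset.sum_insert hi, Finset.prod_insert hi, AddCircle.toCircle_add, ih, fourier_apply]
  exact (h _).symm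

/-- A character of the torus that is trivial on the kernel of an endomorphism factors through
that endomorphism. -/
theorem exists_vecMul_eq_of_mFourier_eq_one {n : ℕ} {B : Matrix (Fin n) (Fin n) ℤ}
    (hB : B.det ≠ 0) (m : Fin n → ℤ) (h : ∀ x ∈ (phiAHom B).ker, mFourier m x = 1) :
    ∃ z, z ᵥ* B = m := by
  have hd : (B.det : ℝ) ≠ 0 := by exact_mod_cast hB
  have hz (j : Fin n) : ∃ z : ℤ, (m ᵥ* B.adjugate) j = B.det * z := by
    let x : Torus n := fun i => ((B.adjugate i j / B.det : ℝ) : AddCircle (1 : ℝ))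
    have hcomb (v : Fin n → ℤ) : ∑ i, v i • x i =
        (((v ᵥ* B.adjugate) j / B.det : ℝ) : AddCircle (1 : ℝ)) := by
      simp only [x, ← AddCircle.coe_zsmul]
      refine (map_sum (QuotientAddGroup.mk' (AddSubgroup.zmultiples (1 : ℝ))) _ _).symm.trans ?_
      refine congrArg (QuotientAddGroup.mk' (AddSubgroup.zmultiples (1 : ℝ))) ?_
      simp [Matrix.vecMul, dotProduct, Finset.sum_div, mul_div_assoc]
    have hx : x ∈ (phiAHom B).ker := by
      rw [AddMonoidHom.mem_ker]
      ext i
      refine (hcomb (B i)).trans ?_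
      have : (B i ᵥ* B.adjugate) j = (B * B.adjugate) i j := rfl
      rw [this, Matrix.mul_adjugate, Pi.zero_apply, AddCircle.coe_eq_zero_iff]
      refine ⟨(1 : Matrix (Fin n) (Fin n) ℤ) i j, ?_⟩
      simp [hd]
    have h1 := h x hx
    rw [mFourier_eq_toCircle, ← Circle.coe_one, Circle.coe_inj, ← AddCircle.toCircle_zero,
      (AddCircle.injective_toCircle one_ne_zero).eq_iff, hcomb, AddCircle.coe_eq_zero_iff] at h1
    obtain ⟨z, hz⟩ := h1
    refine ⟨z, ?_⟩
    rw [eq_div_iff hd] at hz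
    have : ((m ᵥ* B.adjugate) j : ℝ) = ((B.det * z : ℤ) : ℝ) := by
      rw [← hz]; push_cast; simp [mul_comm]
    exact_mod_cast this
  choose z hz using hz
  refine ⟨z, ?_⟩
  have h2 : B.det • (z ᵥ* B) = B.det • m := by
    have h3 : m ᵥ* B.adjugate = B.det • z := funext hz
    rw [← Matrix.smul_vecMul, ← h3, Matrix.vecMul_vecMul, Matrix.adjugate_mul,
      Matrix.vecMul_smul, Matrix.vecMul_one]
  exact smul_right_injective _ hB h2

/-- The preimages of `0` under the iterates of an endomorphism of the torus are dense if the
characteristic polynomial has no unimodular factor. -/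
theorem dense_iUnion_ker_phiAHom_pow {n : ℕ} {A : Matrix (Fin n) (Fin n) ℤ} (hA : A.det ≠ 0)
    (hdiv : ¬ ∃ q : ℤ[X], IsUnimodular q ∧ q ∣ A.charpoly) :
    Dense (⋃ k : ℕ, ((phiAHom (A ^ k)).ker : Set (Torus n))) := by
  have hdet (k : ℕ) : (A ^ k).det ≠ 0 := by rw [Matrix.det_pow]; exact pow_ne_zero k hA
  have (k : ℕ) : Finite (phiAHom (A ^ k)).ker := finite_ker_phiAHom (hdet k)
  refine dense_iUnion_of_mFourier_ne_one (fun k => (phiAHom (A ^ k)).ker)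
    (monotone_nat_of_le_succ fun k x hx => ?_) fun m hm => ?_
  · rw [AddMonoidHom.mem_ker] at hx ⊢
    rw [phiAHom_apply, pow_succ', phiA_mul, ← phiAHom_apply (A ^ k), hx, ← phiAHom_apply,
      map_zero]
  · by_contra! hcon
    refine hm ?_
    rw [← Submodule.mem_bot ℤ, ← Matrix.divisibleVectors_eq_bot hA hdiv,
      Matrix.mem_divisibleVectors]
    exact fun k => exists_vecMul_eq_of_mFourier_eq_one (hdet k) m (hcon k)

open scoped Pointwise in
theorem exactMap_phiA {n : ℕ} {A : Matrix (Fin n) (Fin n) ℤ} (hA : A.det ≠ 0)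
    (hdiv : ¬ ∃ q : ℤ[X], IsUnimodular q ∧ q ∣ A.charpoly) : ExactMap (phiA A) := by
  intro V hV ⟨v, hv⟩
  have hmono : Monotone fun k : ℕ => V + ((phiAHom (A ^ k)).ker : Set (Torus n)) := by
    refine monotone_nat_of_le_succ fun k => Set.add_subset_add_left fun x hx => ?_
    rw [SetLike.mem_coe, AddMonoidHom.mem_ker] at hx ⊢
    rw [phiAHom_apply, pow_succ', phiA_mul, ← phiAHom_apply (A ^ k), hx, ← phiAHom_apply,
      map_zero]
  have hcover : Set.univ ⊆ ⋃ k : ℕ, V + ((phiAHom (A ^ k)).ker : Set (Torus n)) := by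
    intro x _
    have hW : IsOpen ((fun y : Torus n => x - y) ⁻¹' V) := hV.preimage (by fun_prop)
    obtain ⟨y, hyV, hy⟩ := (dense_iUnion_ker_phiAHom_pow hA hdiv).inter_open_nonempty _ hW
      ⟨x - v, by simpa using hv⟩
    obtain ⟨k, hk⟩ := Set.mem_iUnion.1 hy
    exact Set.mem_iUnion.2 ⟨k, Set.mem_add.2 ⟨x - y, hyV, y, hk, sub_add_cancel x y⟩⟩
  obtain ⟨N, hN⟩ := isCompact_univ.elim_directed_cover _ (fun k => hV.add_right) hcover
    hmono.directed_le
  refine ⟨N, Set.eq_univ_of_forall fun y => ?_⟩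
  obtain ⟨x, rfl⟩ := (phiA_surjective hA).iterate N y
  obtain ⟨w, hw, z, hz, rfl⟩ := Set.mem_add.1 (hN (Set.mem_univ x))
  refine ⟨w, hw, ?_⟩
  rw [phiA_iterate, phiA_iterate, ← phiAHom_apply, ← phiAHom_apply, map_add,
    (AddMonoidHom.mem_ker).1 hz, add_zero]

theorem ExactMap.of_semiconj {X Y : Type*} [TopologicalSpace X] [TopologicalSpace Y]
    {f : X → X} {g : Y → Y} (hg : ExactMap g) (h : X ≃ₜ Y) (hfg : Function.Semiconj h f g) :
    ExactMap f := by
  intro V hV hne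
  obtain ⟨N, hN⟩ := hg (h '' V) (h.isOpenMap V hV) (hne.image h)
  refine ⟨N, Set.image_injective.2 h.injective ?_⟩
  rw [Set.image_univ, h.surjective.range_eq, ← hN, ← Set.image_comp, ← Set.image_comp,
    (hfg.iterate_right N).comp_eq]

theorem Matrix.det_sub_one_ne_zero_of_charpoly {ι : Type*} [Fintype ι] [DecidableEq ι]
    {A : Matrix ι ι ℤ} (hdiv : ¬ ∃ q : ℤ[X], IsUnimodular q ∧ q ∣ A.charpoly) :
    (A - 1).det ≠ 0 := by
  intro h
  refine hdiv ⟨X - C 1, ⟨monic_X_sub_C 1, by rw [natDegree_X_sub_C]; exact one_pos, by simp⟩,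
    dvd_iff_isRoot.2 ?_⟩
  rw [IsRoot, Matrix.eval_charpoly, ← neg_sub, Matrix.det_neg, map_one, h, mul_zero]

theorem stmt5 {n : ℕ} (A : Matrix (Fin n) (Fin n) ℤ) (hA : A.det ≠ 0)
    (hdiv : ¬ ∃ q : Polynomial ℤ, IsUnimodular q ∧ q ∣ A.charpoly)
    (lam : Torus n)
    (hT : IsLocalHomeomorph (fun x : Torus n => lam + phiA A x)) :
    ExactMap (fun x : Torus n => lam + phiA A x) ∧
      ∃ h : Torus n ≃ₜ Torus n, ∀ x : Torus n,
        h (lam + phiA A x) = phiA A (h x) := by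
  obtain ⟨x₀, hx₀⟩ := phiA_surjective (Matrix.det_sub_one_ne_zero_of_charpoly hdiv) lam
  rw [phiA_sub, phiA_one] at hx₀
  have hconj (x : Torus n) :
      Homeomorph.addRight x₀ (lam + phiA A x) = phiA A (Homeomorph.addRight x₀ x) := by
    simp only [Homeomorph.coe_addRight, ← phiAHom_apply, map_add, ← hx₀]
    abel
  exact ⟨(exactMap_phiA hA hdiv).of_semiconj _ hconj, _, hconj⟩
end

section
/- Let μ : M₃(ℤ) → M₄(ℤ) be a map such that μ(AB) = μ(A)μ(B) for all A, B ∈ M₃(ℤ) and μ(diag(a,b,c)) = diag(1, bc, ac, ab) for all a, b, c ∈ ℤ. Then there exists a diagonal matrix W ∈ M₃(ℤ), equal to one of diag(1,1,1), diag(1,1,−1), diag(−1,1,1), diag(−1,1,−1), such that for every A ∈ M₃(ℤ), μ(A) is the block diagonal matrix with 1 × 1 block (1) and 3 × 3 block W·cof(A)·W, where cof(A) is the matrix of cofactors of A, i.e. the transpose of the adjugate of A. -/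
/-- The matrix of cofactors of `A`, i.e. the transpose of the adjugate of `A`. -/
def cof {R : Type*} [CommRing R] {n : ℕ} (A : Matrix (Fin n) (Fin n) R) :
    Matrix (Fin n) (Fin n) R :=
  Matrix.transpose (Matrix.adjugate A)

/-- The `4 × 4` block diagonal matrix whose `(1,1)` entry is `d`, whose lower-right
`3 × 3` block is `B`, and whose remaining entries are `0`. -/
def blockDiag1 (d : ℤ) (B : Matrix (Fin 3) (Fin 3) ℤ) : Matrix (Fin 4) (Fin 4) ℤ :=
  Matrix.reindex finSumFinEquiv finSumFinEquiv
    (Matrix.fromBlocks (Matrix.diagonal (fun _ : Fin 1 => d)) 0 0 B)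

open Matrix in
/-- Multiplicative maps on integer matrices that agree on diagonal matrices and on elementary
transvections are equal, as soon as the images of nonzero scalar matrices are left regular. -/
theorem Matrix.mulHom_int_ext {n M : Type*} [Fintype n] [DecidableEq n] [Semigroup M]
    {f g : Matrix n n ℤ → M} (hf : ∀ A B, f (A * B) = f A * f B) (hg : ∀ A B, g (A * B) = g A * g B)
    (hdiag : ∀ d : n → ℤ, f (diagonal d) = g (diagonal d))
    (htrans : ∀ i j : n, i ≠ j → f (transvection i j 1) = g (transvection i j 1))
    (hreg : ∀ m : ℤ, m ≠ 0 → IsLeftRegular (f (diagonal fun _ => m))) : f = g := by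
  let P : Matrix n n ℚ → Prop := fun A =>
    ∃ m : ℤ, m ≠ 0 ∧ ∃ B : Matrix n n ℤ, B.map (Int.cast : ℤ → ℚ) = (m : ℚ) • A ∧ f B = g B
  have hPdiag (d : n → ℚ) : P (diagonal d) := by
    obtain ⟨⟨m, hm⟩, h⟩ := IsLocalization.exist_integer_multiples_of_finite (nonZeroDivisors ℤ) d
    choose e he using h
    refine ⟨m, nonZeroDivisors.ne_zero hm, diagonal e, ?_, hdiag e⟩
    ext i j
    rcases eq_or_ne i j with rfl | hij
    · simpa using he i
    · simp [hij]
  have hPmul (A B : Matrix n n ℚ) (hA : P A) (hB : P B) : P (A * B) := by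
    obtain ⟨a, ha, A', hA', hfA⟩ := hA
    obtain ⟨b, hb, B', hB', hfB⟩ := hB
    refine ⟨a * b, mul_ne_zero ha hb, A' * B', ?_, by rw [hf, hg, hfA, hfB]⟩
    have := Matrix.map_mul (L := A') (M := B') (f := Int.castRingHom ℚ)
    simp only [Int.coe_castRingHom] at this
    rw [this, hA', hB', smul_mul_smul_comm, Int.cast_mul]
  have hPtrans (i j : n) (hij : i ≠ j) (c : ℚ) : P (transvection i j c) := by
    rcases eq_or_ne c 0 with rfl | hc
    · simpa using hPdiag 1
    have hone : P (transvection i j 1) := by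
      refine ⟨1, one_ne_zero, transvection i j 1, ?_, htrans i j hij⟩
      ext k l
      simp [transvection, one_apply, single_apply]
    have hconj : transvection i j c = diagonal (Function.update 1 i c) * transvection i j 1 *
        diagonal (Function.update 1 i c⁻¹) := by
      ext k l
      rw [mul_diagonal, diagonal_mul]
      simp only [transvection, add_apply, one_apply, single_apply, Function.update_apply,
        Pi.one_apply]
      grind
    rw [hconj]
    exact hPmul _ _ (hPmul _ _ (hPdiag _) hone) (hPdiag _)
  funext A
  obtain ⟨m, hm, B, hB, hfB⟩ : P (A.map Int.cast) :=
    diagonal_transvection_induction P _ (fun D _ => hPdiag D)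
      (fun t => hPtrans t.i t.j t.hij t.c) hPmul
  have hBA : B = diagonal (fun _ => m) * A := by
    ext i j
    have := congr_fun₂ hB i j
    rw [diagonal_mul]
    simp only [map_apply, smul_apply, smul_eq_mul] at this
    exact_mod_cast this
  refine hreg m hm ?_
  change f _ * f A = f _ * g A
  rw [← hf, ← hBA, hfB, hBA, hg, hdiag]

/-- A multiplicative map on `3 × 3` integer matrices which acts on diagonal matrices as the matrix of
cofactors sends elementary transvections to transvections for the transposed position. -/
theorem exists_map_transvection_eq {ν : Matrix (Fin 3) (Fin 3) ℤ → Matrix (Fin 3) (Fin 3) ℤ}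
    (hmul : ∀ A B, ν (A * B) = ν A * ν B)
    (hdiag : ∀ d : Fin 3 → ℤ,
      ν (Matrix.diagonal d) = Matrix.diagonal ![d 1 * d 2, d 0 * d 2, d 0 * d 1])
    (i j : Fin 3) (hij : i ≠ j) :
    ∃ p : ℤ, ν (Matrix.transvection i j 1) = Matrix.transvection j i p := by
  obtain ⟨k, hki, hkj⟩ : ∃ k, k ≠ i ∧ k ≠ j := by revert i j; decide
  have hleft : Matrix.diagonal (Function.update 1 i 0) * Matrix.transvection i j (1 : ℤ) =
      Matrix.diagonal (Function.update 1 i 0) := by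
    clear k hki hkj; revert i j; decide
  have hright : Matrix.transvection i j (1 : ℤ) * Matrix.diagonal (Function.update 1 j 0) =
      Matrix.diagonal (Function.update 1 j 0) := by
    clear k hki hkj hleft; revert i j; decide
  have hcomm : Matrix.transvection i j (1 : ℤ) * Matrix.diagonal (Function.update 1 k 0) =
      Matrix.diagonal (Function.update 1 k 0) * Matrix.transvection i j 1 := by
    clear hleft hright; revert i j k; decide
  have hsq : Matrix.diagonal (Function.update 1 i 2) * Matrix.transvection i j (1 : ℤ) =
      Matrix.transvection i j 1 * Matrix.transvection i j 1 *
        Matrix.diagonal (Function.update 1 i 2) := by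
    clear k hki hkj hleft hright hcomm; revert i j; decide
  have hinv : Matrix.transvection i j (1 : ℤ) * Matrix.diagonal (Function.update 1 i (-1)) *
      Matrix.transvection i j 1 = Matrix.diagonal (Function.update 1 i (-1)) := by
    clear k hki hkj hleft hright hcomm hsq; revert i j; decide
  refine ⟨ν (Matrix.transvection i j 1) j i, ?_⟩
  replace hleft := congr_arg ν hleft
  replace hright := congr_arg ν hright
  replace hsq := congr_arg ν hsq
  replace hinv := congr_arg ν hinv
  replace hcomm := congr_arg ν hcomm
  simp only [hmul, hdiag] at hleft hright hsq hinv hcomm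
  generalize ν (Matrix.transvection i j 1) = N at *
  clear hmul hdiag
  fin_cases i <;> fin_cases j <;> fin_cases k <;> simp at hij hki hkj <;>
  · simp [← Matrix.ext_iff, Fin.forall_fin_succ, Matrix.mul_apply, Fin.sum_univ_three,
      Matrix.transvection, Matrix.single_apply, Matrix.one_apply, Matrix.diagonal_apply] at *
    grind

/-- A multiplicative map on `3 × 3` integer matrices which acts on diagonal matrices as the matrix of
cofactors is the matrix of cofactors up to conjugation by a diagonal sign matrix. -/
theorem exists_sign_eq_cof {ν : Matrix (Fin 3) (Fin 3) ℤ → Matrix (Fin 3) (Fin 3) ℤ}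
    (hmul : ∀ A B, ν (A * B) = ν A * ν B)
    (hdiag : ∀ d : Fin 3 → ℤ,
      ν (Matrix.diagonal d) = Matrix.diagonal ![d 1 * d 2, d 0 * d 2, d 0 * d 1]) :
    ∃ u v : ℤ, (u = 1 ∨ u = -1) ∧ (v = 1 ∨ v = -1) ∧ ∀ A,
      ν A = Matrix.diagonal ![u, 1, v] * cof A * Matrix.diagonal ![u, 1, v] := by
  choose! p hp using exists_map_transvection_eq hmul hdiag
  have hcomm : p 0 2 = -(p 0 1 * p 1 2) := by
    have h : Matrix.transvection (0 : Fin 3) 1 (1 : ℤ) * Matrix.transvection 1 2 1 =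
        Matrix.transvection 0 2 1 * Matrix.transvection 1 2 1 * Matrix.transvection 0 1 1 := by
      decide
    replace h := congr_arg ν h
    rw [hmul, hmul, hmul, hp 0 1 (by decide), hp 1 2 (by decide), hp 0 2 (by decide)] at h
    replace h := congr_fun₂ h 2 0
    simp [Matrix.mul_apply, Fin.sum_univ_three, Matrix.transvection, Matrix.single_apply,
      Matrix.one_apply] at h
    linarith
  have hinv (i j : Fin 3) (hij : i ≠ j) : p i j * p j i = 1 := by
    have h : Matrix.diagonal (Function.update 1 j 0) * Matrix.transvection i j (1 : ℤ) *
        Matrix.transvection j i 1 * Matrix.diagonal (Function.update 1 j 0) =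
        Matrix.diagonal (Function.update (Function.update 1 j 0) i 2) := by
      clear hp hcomm; revert i j; decide
    replace h := congr_fun₂ (congr_arg ν h) j j
    simp only [hmul, hdiag, hp i j hij, hp j i hij.symm] at h
    fin_cases i <;> fin_cases j <;> simp at hij <;>
    · simp [Matrix.mul_apply, Fin.sum_univ_three, Matrix.transvection, Matrix.single_apply,
        Matrix.one_apply, Matrix.diagonal_apply] at h ⊢
      linarith
  have h₁ := hinv 0 1 (by decide)
  have h₂ := hinv 1 2 (by decide)
  have h₃ := hinv 0 2 (by decide)
  have hu := Int.isUnit_iff.mp (IsUnit.of_mul_eq_one _ h₁)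
  have hv := Int.isUnit_iff.mp (IsUnit.of_mul_eq_one _ h₂)
  refine ⟨-p 0 1, -p 1 2, by lia, by lia, congr_fun ?_⟩
  set W : Matrix (Fin 3) (Fin 3) ℤ := Matrix.diagonal ![-p 0 1, 1, -p 1 2] with hW
  have hWW : W * W = 1 := by
    rw [hW, Matrix.diagonal_mul_diagonal, ← Matrix.diagonal_one]
    congr 1
    ext k
    fin_cases k <;> simp <;> grind
  refine Matrix.mulHom_int_ext hmul (fun A B => ?_) (fun d => ?_) (fun i j hij => ?_)
    (fun m hm A B hAB => ?_)
  · rw [cof, Matrix.adjugate_mul_distrib, Matrix.transpose_mul]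
    calc _ = W * cof A * 1 * cof B * W := by simp [cof, Matrix.mul_assoc]
      _ = _ := by rw [← hWW]; simp only [Matrix.mul_assoc]
  · rw [hdiag, hW]
    ext a b
    rw [Matrix.mul_diagonal, Matrix.diagonal_mul, cof, Matrix.adjugate_fin_three]
    fin_cases a <;> fin_cases b <;> simp <;> grind
  · rw [hp i j hij, hW]
    ext a b
    rw [Matrix.mul_diagonal, Matrix.diagonal_mul, cof, Matrix.adjugate_fin_three]
    fin_cases i <;> fin_cases j <;> simp at hij <;> fin_cases a <;> fin_cases b <;>
      simp [Matrix.transvection] <;> grind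
  · rw [hdiag] at hAB
    ext a b
    have := congr_fun₂ hAB a b
    simp only [Matrix.diagonal_mul] at this
    fin_cases a <;> simpa [hm] using this

theorem stmt17 (μ : Matrix (Fin 3) (Fin 3) ℤ → Matrix (Fin 4) (Fin 4) ℤ)
    (hmul : ∀ A B : Matrix (Fin 3) (Fin 3) ℤ, μ (A * B) = μ A * μ B)
    (hdiag : ∀ a b c : ℤ,
      μ (Matrix.diagonal ![a, b, c]) = Matrix.diagonal ![1, b * c, a * c, a * b]) :
    ∃ W : Matrix (Fin 3) (Fin 3) ℤ,
      (W = Matrix.diagonal ![1, 1, 1] ∨ W = Matrix.diagonal ![1, 1, -1] ∨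
        W = Matrix.diagonal ![-1, 1, 1] ∨ W = Matrix.diagonal ![-1, 1, -1]) ∧
      ∀ A : Matrix (Fin 3) (Fin 3) ℤ, μ A = blockDiag1 1 (W * cof A * W) := by
  have hE : μ 0 = Matrix.diagonal ![1, 0, 0, 0] := by
    have h := hdiag 0 0 0
    rwa [show ![(0 : ℤ), 0, 0] = fun _ => 0 by ext k; fin_cases k <;> rfl, Matrix.diagonal_zero,
      mul_zero] at h
  set ν : Matrix (Fin 3) (Fin 3) ℤ → Matrix (Fin 3) (Fin 3) ℤ :=
    fun A => (μ A).submatrix Fin.succ Fin.succ with hν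
  have hrow (A : Matrix (Fin 3) (Fin 3) ℤ) (b : Fin 4) :
      μ A 0 b = (1 : Matrix (Fin 4) (Fin 4) ℤ) 0 b := by
    have h := congr_fun₂ (hmul 0 A) 0 b
    rw [zero_mul, hE, Matrix.diagonal_mul] at h
    fin_cases b <;> simp at h <;> exact h.symm
  have hcol (A : Matrix (Fin 3) (Fin 3) ℤ) (a : Fin 4) :
      μ A a 0 = (1 : Matrix (Fin 4) (Fin 4) ℤ) a 0 := by
    have h := congr_fun₂ (hmul A 0) a 0
    rw [mul_zero, hE, Matrix.mul_diagonal] at h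
    fin_cases a <;> simp at h <;> exact h.symm
  have hμ (A : Matrix (Fin 3) (Fin 3) ℤ) : μ A = blockDiag1 1 (ν A) := by
    ext a b
    refine Fin.cases ?_ (fun a => ?_) a
    · rw [hrow]; fin_cases b <;> rfl
    · refine Fin.cases ?_ (fun b => ?_) b
      · rw [hcol]; fin_cases a <;> rfl
      · fin_cases a <;> fin_cases b <;> rfl
  have hνmul (A B : Matrix (Fin 3) (Fin 3) ℤ) : ν (A * B) = ν A * ν B := by
    ext a b
    simp [hν, hmul, Matrix.mul_apply, Fin.sum_univ_succ (n := 3), hcol]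
  have hνdiag (d : Fin 3 → ℤ) :
      ν (Matrix.diagonal d) = Matrix.diagonal ![d 1 * d 2, d 0 * d 2, d 0 * d 1] := by
    have hd : d = ![d 0, d 1, d 2] := by ext k; fin_cases k <;> rfl
    have h := hdiag (d 0) (d 1) (d 2)
    rw [← hd] at h
    ext a b
    simp only [hν, h]
    fin_cases a <;> fin_cases b <;> rfl
  obtain ⟨u, v, hu, hv, h⟩ := exists_sign_eq_cof hνmul hνdiag
  refine ⟨Matrix.diagonal ![u, 1, v], ?_, fun A => by rw [hμ, h]⟩
  rcases hu with rfl | rfl <;> rcases hv with rfl | rfl <;> simp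
end
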